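/- arXiv:1807.10618 — 2 statements merged into one kernel-verified Lean document; each statement's English description precedes it below -/
import Mathlib

section
/- (Lemma 1, inequality part.) With b = (k+1)/n, the prior adjusted default Bayes factor of the order-constrained hypothesis H₂: R_I β > r_I against the unconstrained hypothesis equals the ratio of the posterior and adjusted fractional prior probabilities of the constrained region: [N/Dn] / [m_u(1)/m_u(b)] = [∫_{{β : R_I β > r_I}} t(β; β̂, s²(n−k)⁻¹(XᵀX)⁻¹, n−k) dβ] / [∫_{{β : R_I β > R_I β̂}} t(β; β̂, s²(XᵀX)⁻¹, 1) dβ], where N = ∫_{{β : R_I β > r_I}} ∫₀^∞ (2πσ²)^{−n/2} exp(−‖y − Xβ‖²/(2σ²)) (σ²)⁻¹ dσ² dβ, Dn = ∫_{{β : R_I β > R_I β̂}} ∫₀^∞ (2πσ²)^{−nb/2} exp(−b‖y − Xβ‖²/(2σ²)) (σ²)⁻¹ dσ² dβ, and m_u(c) = ∫_{ℝ^k} ∫₀^∞ (2πσ²)^{−nc/2} exp(−c‖y − Xβ‖²/(2σ²)) (σ²)⁻¹ dσ² dβ. -/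
open Matrix MeasureTheory

/-- The multivariate Student `t` density. -/
noncomputable def studentT {d : ℕ} (ν : ℝ) (m : Fin d → ℝ)
    (S : Matrix (Fin d) (Fin d) ℝ) (x : Fin d → ℝ) : ℝ :=
  Real.Gamma ((ν + d) / 2) /
      (Real.Gamma (ν / 2) * (ν * Real.pi) ^ ((d : ℝ) / 2) * Real.sqrt S.det) *
    (1 + (x - m) ⬝ᵥ S⁻¹.mulVec (x - m) / ν) ^ (-(ν + d) / 2)

/-- `∫₀^∞ (2πσ²)^{−nc/2} exp(−c·q/(2σ²)) (σ²)⁻¹ dσ²`. -/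
noncomputable def fracInt (n : ℕ) (c q : ℝ) : ℝ :=
  ∫ t in Set.Ioi (0 : ℝ),
    (2 * Real.pi * t) ^ (-((n : ℝ) * c) / 2) * Real.exp (-(c * q) / (2 * t)) * t⁻¹

/-- The OLS estimate `β̂ = (XᵀX)⁻¹Xᵀy`. -/
noncomputable def betaHat {n k : ℕ} (y : Fin n → ℝ) (X : Matrix (Fin n) (Fin k) ℝ) :
    Fin k → ℝ := (Xᵀ * X)⁻¹.mulVec (Xᵀ.mulVec y)

/-- The sum of squares `s² = ‖y − Xβ̂‖²`. -/
noncomputable def sSq {n k : ℕ} (y : Fin n → ℝ) (X : Matrix (Fin n) (Fin k) ℝ) : ℝ :=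
  (y - X.mulVec (betaHat y X)) ⬝ᵥ (y - X.mulVec (betaHat y X))

/-- Unconstrained fractional marginal likelihood `m_u(c)`. -/
noncomputable def mU {n k : ℕ} (y : Fin n → ℝ) (X : Matrix (Fin n) (Fin k) ℝ)
    (c : ℝ) : ℝ :=
  ∫ β : Fin k → ℝ, fracInt n c ((y - X.mulVec β) ⬝ᵥ (y - X.mulVec β))

theorem fracInt_eq_const_mul_rpow {n : ℕ} {c q : ℝ} (hn : 0 < (n : ℝ) * c) (hc : 0 < c)
    (hq : 0 < q) :
    fracInt n c q = ((Real.pi * c) ^ (-((n : ℝ) * c) / 2) * Real.Gamma ((n : ℝ) * c / 2)) *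
      q ^ (-((n : ℝ) * c) / 2) := by
  set a : ℝ := (n : ℝ) * c / 2 with ha
  have ha0 : 0 < a := by positivity
  have hna : -((n : ℝ) * c) / 2 = -a := by rw [ha]; ring
  have hr : 0 < c * q / 2 := by positivity
  have hpi := Real.pi_pos
  have hsub := integral_comp_rpow_Ioi
    (fun u : ℝ => u ^ (a - 1) * Real.exp (-(c * q / 2 * u))) (p := -1) (by norm_num)
  rw [Real.integral_rpow_mul_exp_neg_mul_Ioi ha0 hr] at hsub
  have hpt : ∀ t ∈ Set.Ioi (0 : ℝ),
      (2 * Real.pi * t) ^ (-a) * Real.exp (-(c * q) / (2 * t)) * t⁻¹ =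
      (2 * Real.pi) ^ (-a) * ((|(-1 : ℝ)| * t ^ ((-1 : ℝ) - 1)) •
        ((t ^ (-1 : ℝ)) ^ (a - 1) * Real.exp (-(c * q / 2 * t ^ (-1 : ℝ))))) := by
    intro t ht
    have ht0 : (0 : ℝ) < t := ht
    rw [Real.mul_rpow (by positivity) ht0.le, ← Real.rpow_mul ht0.le, abs_neg, abs_one, one_mul,
      smul_eq_mul, ← mul_assoc (t ^ ((-1 : ℝ) - 1)), ← Real.rpow_add ht0]
    have h1 : -(c * q) / (2 * t) = -(c * q / 2 * t ^ (-1 : ℝ)) := by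
      rw [Real.rpow_neg_one]; field_simp
    have h2 : t ^ ((-1 : ℝ) - 1 + -1 * (a - 1)) = t ^ (-a) * t⁻¹ := by
      rw [← Real.rpow_neg_one t, ← Real.rpow_add ht0]; congr 1; ring
    rw [h1, h2]; ring
  unfold fracInt
  rw [hna, setIntegral_congr_fun measurableSet_Ioi hpt, integral_const_mul, hsub, one_div,
    Real.inv_rpow hr.le, ← Real.rpow_neg hr.le, ← mul_assoc, ← Real.mul_rpow (by positivity) hr.le,
    show 2 * Real.pi * (c * q / 2) = Real.pi * c * q by ring, Real.mul_rpow (by positivity) hq.le]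
  ring

theorem exp_neg_mul_dotProduct_self {d : ℕ} (c : ℝ) (v : Fin d → ℝ) :
    Real.exp (-c * (v ⬝ᵥ v)) = ∏ i, Real.exp (-c * v i ^ 2) := by
  rw [← Real.exp_sum, dotProduct, Finset.mul_sum]
  simp only [sq]

theorem integrable_exp_neg_mul_dotProduct_self (d : ℕ) {c : ℝ} (hc : 0 < c) :
    Integrable (fun v : Fin d → ℝ => Real.exp (-c * (v ⬝ᵥ v))) := by
  simp only [exp_neg_mul_dotProduct_self]
  exact Integrable.fintype_prod (fun _ => integrable_exp_neg_mul_sq hc)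

theorem integral_exp_neg_mul_dotProduct_self (d : ℕ) {c : ℝ} (hc : 0 < c) :
    ∫ v : Fin d → ℝ, Real.exp (-c * (v ⬝ᵥ v)) = (Real.pi / c) ^ ((d : ℝ) / 2) := by
  have hpi := Real.pi_pos
  simp only [exp_neg_mul_dotProduct_self]
  rw [integral_fintype_prod_volume_eq_pow (fun x : ℝ => Real.exp (-c * x ^ 2)),
    integral_gaussian, Fintype.card_fin, Real.sqrt_eq_rpow, ← Real.rpow_natCast,
    ← Real.rpow_mul (by positivity)]
  congr 1; ring

theorem integral_one_add_dotProduct_self_rpow (d : ℕ) {ν : ℝ} (hν : 0 < ν) :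
    Real.Gamma ((ν + d) / 2) * ∫ v : Fin d → ℝ, (1 + v ⬝ᵥ v / ν) ^ (-(ν + d) / 2) =
      Real.Gamma (ν / 2) * (ν * Real.pi) ^ ((d : ℝ) / 2) := by
  have hpi := Real.pi_pos
  set a : ℝ := (ν + d) / 2 with ha
  have ha0 : 0 < a := by positivity
  let F : (Fin d → ℝ) × ℝ → ℝ := fun p =>
    p.2 ^ (a - 1) * Real.exp (-p.2) * Real.exp (-(p.2 / ν) * (p.1 ⬝ᵥ p.1))
  have hmeas : Measurable F := by
    have : Measurable fun p : (Fin d → ℝ) × ℝ => p.1 ⬝ᵥ p.1 := by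
      unfold dotProduct; fun_prop
    fun_prop
  have hinner : ∀ t ∈ Set.Ioi (0 : ℝ), ∫ v, F (v, t) =
      (ν * Real.pi) ^ ((d : ℝ) / 2) * (Real.exp (-t) * t ^ (ν / 2 - 1)) := by
    intro t ht
    have ht0 : (0 : ℝ) < t := ht
    simp only [F]
    rw [integral_const_mul, integral_exp_neg_mul_dotProduct_self d (by positivity),
      show Real.pi / (t / ν) = (ν * Real.pi) * t⁻¹ by field_simp,
      Real.mul_rpow (by positivity) (by positivity), Real.inv_rpow ht0.le, ← Real.rpow_neg ht0.le,
      show ν / 2 - 1 = (a - 1) + -((d : ℝ) / 2) by rw [ha]; ring, Real.rpow_add ht0]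
    ring
  have hF : Integrable F (volume.prod (volume.restrict (Set.Ioi 0))) := by
    rw [integrable_prod_iff' hmeas.aestronglyMeasurable]
    constructor
    · filter_upwards [ae_restrict_mem measurableSet_Ioi] with t ht
      have ht0 : (0 : ℝ) < t := ht
      exact (integrable_exp_neg_mul_dotProduct_self d (div_pos ht0 hν)).const_mul
        (t ^ (a - 1) * Real.exp (-t))
    · have h : IntegrableOn (fun t : ℝ => (ν * Real.pi) ^ ((d : ℝ) / 2) *
          (Real.exp (-t) * t ^ (ν / 2 - 1))) (Set.Ioi 0) :=
        (Real.GammaIntegral_convergent (by positivity)).const_mul _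
      refine IntegrableOn.congr_fun h (fun t ht => ?_) measurableSet_Ioi
      have ht0 : (0 : ℝ) < t := ht
      rw [← hinner t ht]
      refine integral_congr_ae (Filter.Eventually.of_forall fun v => ?_)
      exact (Real.norm_of_nonneg (by simp only [F]; positivity)).symm
  have houter : ∀ v : Fin d → ℝ, ∫ t in Set.Ioi (0 : ℝ), F (v, t) =
      Real.Gamma a * (1 + v ⬝ᵥ v / ν) ^ (-(ν + d) / 2) := by
    intro v
    have hv : 0 ≤ v ⬝ᵥ v := Finset.sum_nonneg fun i _ => mul_self_nonneg _
    have hr : 0 < 1 + v ⬝ᵥ v / ν := by positivity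
    have h := Real.integral_rpow_mul_exp_neg_mul_Ioi ha0 hr
    rw [one_div, Real.inv_rpow hr.le, ← Real.rpow_neg hr.le] at h
    rw [show -(ν + d) / 2 = -a by rw [ha]; ring, mul_comm, ← h]
    congr 1 with t
    simp only [F]
    rw [mul_assoc, ← Real.exp_add]
    congr 2; ring
  have hswap := integral_integral_swap (f := fun v t => F (v, t)) hF
  simp only [houter] at hswap
  rw [setIntegral_congr_fun measurableSet_Ioi hinner, integral_const_mul, integral_const_mul,
    ← Real.Gamma_eq_integral (by positivity)] at hswap
  rw [hswap, mul_comm]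

theorem integral_comp_mulVec {d : ℕ} {B : Matrix (Fin d) (Fin d) ℝ} (hB : B.det ≠ 0)
    (f : (Fin d → ℝ) → ℝ) : ∫ x, f (B *ᵥ x) = |B.det|⁻¹ * ∫ x, f x := by
  have h := Real.map_matrix_volume_pi_eq_smul_volume_pi hB
  have he : MeasurableEmbedding (Matrix.toLin' B) :=
    (Matrix.toLinearEquiv' B (Matrix.invertibleOfIsUnitDet B
      hB.isUnit)).toContinuousLinearEquiv.toHomeomorph.measurableEmbedding
  have := he.integral_map (μ := volume) f
  rw [h, integral_smul_measure] at this
  simp only [Matrix.toLin'_apply] at this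
  rw [← this, ENNReal.toReal_ofReal (abs_nonneg _), abs_inv, smul_eq_mul]

theorem Matrix.PosDef.exists_transpose_mul_self {d : ℕ} {A : Matrix (Fin d) (Fin d) ℝ}
    (hA : A.PosDef) : ∃ B : Matrix (Fin d) (Fin d) ℝ, A = Bᵀ * B := by
  open scoped MatrixOrder Matrix.Norms.L2Operator in
  obtain ⟨B, hB⟩ := CStarAlgebra.nonneg_iff_eq_star_mul_self.mp hA.posSemidef.nonneg
  exact ⟨B, hB⟩

theorem integral_studentT {d : ℕ} {ν : ℝ} (hν : 0 < ν) (m : Fin d → ℝ)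
    {S : Matrix (Fin d) (Fin d) ℝ} (hS : S.PosDef) : ∫ x, studentT ν m S x = 1 := by
  have hpi := Real.pi_pos
  obtain ⟨B, hB⟩ := hS.inv.exists_transpose_mul_self
  have hdet : S.det⁻¹ = B.det ^ 2 := by
    rw [← Ring.inverse_eq_inv', ← Matrix.det_nonsing_inv, hB, Matrix.det_mul,
      Matrix.det_transpose, sq]
  have hBdet : B.det ≠ 0 := fun h => by
    rw [h] at hdet
    exact inv_ne_zero hS.det_pos.ne' (by simpa using hdet)
  have hsqrt : Real.sqrt S.det = |B.det|⁻¹ := by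
    rw [← inv_inv S.det, hdet, Real.sqrt_inv, Real.sqrt_sq_eq_abs]
  have hquad : ∀ x : Fin d → ℝ, x ⬝ᵥ S⁻¹ *ᵥ x = (B *ᵥ x) ⬝ᵥ (B *ᵥ x) := by
    intro x
    rw [hB, ← Matrix.mulVec_mulVec, Matrix.dotProduct_mulVec, Matrix.vecMul_transpose]
  unfold studentT
  rw [integral_const_mul, integral_sub_right_eq_self
    (fun x => (1 + x ⬝ᵥ S⁻¹ *ᵥ x / ν) ^ (-(ν + d) / 2)) m]
  simp only [hquad]
  rw [integral_comp_mulVec hBdet (fun x => (1 + x ⬝ᵥ x / ν) ^ (-(ν + d) / 2)), hsqrt]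
  have key := integral_one_add_dotProduct_self_rpow d hν
  have hG : 0 < Real.Gamma (ν / 2) := Real.Gamma_pos_of_pos (by positivity)
  have hP : 0 < (ν * Real.pi) ^ ((d : ℝ) / 2) := by positivity
  have hb : |B.det| ≠ 0 := abs_ne_zero.mpr hBdet
  generalize (∫ x : Fin d → ℝ, (1 + x ⬝ᵥ x / ν) ^ (-(ν + d) / 2)) = I at key ⊢
  rw [div_mul_eq_mul_div, div_eq_one_iff_eq (by positivity), mul_left_comm, key, mul_comm]

theorem posDef_transpose_mul_self {n k : ℕ} {X : Matrix (Fin n) (Fin k) ℝ}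
    (hX : IsUnit (Xᵀ * X)) : (Xᵀ * X).PosDef := by
  have h : (Xᵀ * X).PosSemidef := Matrix.posSemidef_conjTranspose_mul_self X
  exact h.posDef_iff_isUnit.mpr hX

theorem residual_dotProduct_self {n k : ℕ} (y : Fin n → ℝ) {X : Matrix (Fin n) (Fin k) ℝ}
    (hX : IsUnit (Xᵀ * X)) (β : Fin k → ℝ) :
    (y - X *ᵥ β) ⬝ᵥ (y - X *ᵥ β) =
      sSq y X + (β - betaHat y X) ⬝ᵥ (Xᵀ * X) *ᵥ (β - betaHat y X) := by
  have hnormal : Xᵀ *ᵥ (y - X *ᵥ betaHat y X) = 0 := by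
    rw [Matrix.mulVec_sub, Matrix.mulVec_mulVec, betaHat, Matrix.mulVec_mulVec,
      Matrix.mul_nonsing_inv _ ((Matrix.isUnit_iff_isUnit_det _).mp hX), Matrix.one_mulVec, sub_self]
  unfold sSq
  set e := y - X *ᵥ betaHat y X with he
  set δ := β - betaHat y X with hδ
  have hsplit : y - X *ᵥ β = e - X *ᵥ δ := by
    rw [he, hδ, Matrix.mulVec_sub]; abel
  have horth : e ⬝ᵥ X *ᵥ δ = 0 := by
    rw [Matrix.dotProduct_mulVec, ← Matrix.mulVec_transpose, hnormal, zero_dotProduct]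
  have hquad : δ ⬝ᵥ (Xᵀ * X) *ᵥ δ = (X *ᵥ δ) ⬝ᵥ (X *ᵥ δ) := by
    rw [← Matrix.mulVec_mulVec, Matrix.dotProduct_mulVec, Matrix.vecMul_transpose]
  clear_value e
  rw [hsplit, sub_dotProduct, dotProduct_sub, dotProduct_sub, dotProduct_comm (X *ᵥ δ) e, horth,
    hquad]
  ring

/-- The integrated fractional likelihood is proportional to a Student `t` density in `β`. -/
theorem exists_fracInt_eq_mul_studentT {n k : ℕ} {y : Fin n → ℝ} {X : Matrix (Fin n) (Fin k) ℝ}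
    (hX : IsUnit (Xᵀ * X)) (hs2 : 0 < sSq y X) {c ν : ℝ} (hc : 0 < c) (hν : 0 < ν)
    (hnc : (n : ℝ) * c = ν + k) :
    ∃ K : ℝ, K ≠ 0 ∧ ∀ β : Fin k → ℝ, fracInt n c ((y - X *ᵥ β) ⬝ᵥ (y - X *ᵥ β)) =
      K * studentT ν (betaHat y X) ((sSq y X / ν) • (Xᵀ * X)⁻¹) β := by
  have hpi := Real.pi_pos
  have hA := posDef_transpose_mul_self hX
  have hn : 0 < (n : ℝ) * c := by rw [hnc]; positivity
  have hr : 0 < sSq y X / ν := by positivity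
  have hS : ((sSq y X / ν) • (Xᵀ * X)⁻¹).PosDef := hA.inv.smul hr
  set S := (sSq y X / ν) • (Xᵀ * X)⁻¹ with hSdef
  have hSinv : S⁻¹ = (sSq y X / ν)⁻¹ • (Xᵀ * X) := by
    apply Matrix.inv_eq_left_inv
    rw [hSdef, Matrix.smul_mul, Matrix.mul_smul, smul_smul, inv_mul_cancel₀ hr.ne', one_smul,
      Matrix.mul_nonsing_inv _ ((Matrix.isUnit_iff_isUnit_det _).mp hX)]
  set L := Real.Gamma ((ν + k) / 2) /
      (Real.Gamma (ν / 2) * (ν * Real.pi) ^ ((k : ℝ) / 2) * Real.sqrt S.det) with hL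
  have hL0 : 0 < L := by
    have h1 : 0 < Real.Gamma ((ν + k) / 2) := Real.Gamma_pos_of_pos (by positivity)
    have h2 : 0 < Real.Gamma (ν / 2) := Real.Gamma_pos_of_pos (by positivity)
    have h3 := Real.sqrt_pos.mpr hS.det_pos
    positivity
  set C := (Real.pi * c) ^ (-((n : ℝ) * c) / 2) * Real.Gamma ((n : ℝ) * c / 2) with hC
  have hC0 : 0 < C := by
    have h1 : 0 < Real.Gamma ((n : ℝ) * c / 2) := Real.Gamma_pos_of_pos (by positivity)
    positivity
  refine ⟨C * sSq y X ^ (-(ν + k) / 2) / L, by positivity, fun β => ?_⟩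
  have hq : 0 ≤ (β - betaHat y X) ⬝ᵥ (Xᵀ * X) *ᵥ (β - betaHat y X) := by
    simpa using hA.posSemidef.dotProduct_mulVec_nonneg (β - betaHat y X)
  rw [residual_dotProduct_self y hX, fracInt_eq_const_mul_rpow hn hc (by positivity), ← hC]
  unfold studentT
  rw [← hL, hSinv, Matrix.smul_mulVec, dotProduct_smul, hnc]
  generalize (β - betaHat y X) ⬝ᵥ (Xᵀ * X) *ᵥ (β - betaHat y X) = q at hq ⊢
  have hfac : sSq y X + q = sSq y X * (1 + (sSq y X / ν)⁻¹ • q / ν) := by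
    rw [smul_eq_mul]; field_simp
  have hpos : 0 ≤ 1 + (sSq y X / ν)⁻¹ • q / ν := by rw [smul_eq_mul]; positivity
  rw [hfac, Real.mul_rpow hs2.le hpos]
  field_simp

/-- **Lemma 1, inequality part.** With `b = (k+1)/n`, the prior adjusted
default Bayes factor of the order-constrained hypothesis `H₂ : R_I β > r_I` against the
unconstrained hypothesis equals the ratio of the posterior and adjusted fractional prior
probabilities of the constrained region. -/
theorem stmt_13 {n k qI : ℕ} (hnk : k < n)
    (y : Fin n → ℝ) (X : Matrix (Fin n) (Fin k) ℝ) (hX : IsUnit (Xᵀ * X))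
    (hs2 : 0 < sSq y X)
    (RI : Matrix (Fin qI) (Fin k) ℝ) (rI : Fin qI → ℝ) :
    let b : ℝ := ((k : ℝ) + 1) / n
    let βhat := betaHat y X
    let N := ∫ β in {β : Fin k → ℝ | ∀ i, rI i < (RI.mulVec β) i},
      fracInt n 1 ((y - X.mulVec β) ⬝ᵥ (y - X.mulVec β))
    let Dn := ∫ β in {β : Fin k → ℝ | ∀ i, (RI.mulVec βhat) i < (RI.mulVec β) i},
      fracInt n b ((y - X.mulVec β) ⬝ᵥ (y - X.mulVec β))
    (N / Dn) / (mU y X 1 / mU y X b) =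
      (∫ β in {β : Fin k → ℝ | ∀ i, rI i < (RI.mulVec β) i},
          studentT ((n : ℝ) - k) βhat ((sSq y X / ((n : ℝ) - k)) • (Xᵀ * X)⁻¹) β) /
        (∫ β in {β : Fin k → ℝ | ∀ i, (RI.mulVec βhat) i < (RI.mulVec β) i},
          studentT 1 βhat (sSq y X • (Xᵀ * X)⁻¹) β) := by
  intro b βhat N Dn
  have hkn : (k : ℝ) < n := by exact_mod_cast hnk
  have hn0 : (0 : ℝ) < n := lt_of_le_of_lt (Nat.cast_nonneg k) hkn
  have hν : 0 < (n : ℝ) - k := sub_pos.mpr hkn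
  have hA := posDef_transpose_mul_self hX
  obtain ⟨K, hK0, hK⟩ := exists_fracInt_eq_mul_studentT hX hs2 one_pos hν (by ring)
  obtain ⟨K', hK'0, hK'⟩ := exists_fracInt_eq_mul_studentT (c := b) hX hs2
    (by positivity) one_pos (by simp only [b]; field_simp; ring)
  rw [div_one] at hK'
  simp only [N, Dn, mU, hK, hK', integral_const_mul]
  rw [integral_studentT hν _ (hA.inv.smul (div_pos hs2 hν)),
    integral_studentT one_pos _ (hA.inv.smul hs2), mul_one, mul_one, mul_div_mul_comm,
    mul_div_cancel_left₀ _ (div_ne_zero hK0 hK'0)]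
end

section
/- (Lemma 1, combined equality-and-inequality part; Appendix A decomposition.) With b = (k+1)/n, R̃_I = R_I Dᵀ(DDᵀ)⁻¹, r̃_I = r_I − R_I R_Eᵀ(R_E R_Eᵀ)⁻¹ r_E, ξ̂ = T β̂ = (ξ̂_E, ξ̂_I), constrained regions C = {ξ_I : R̃_I ξ_I > r̃_I} and C* = {ξ_I : R̃_I ξ_I > R̃_I ξ̂_I}, the prior adjusted default Bayes factor of H₃: R_E β = r_E, R_I β > r_I against the unconstrained hypothesis factorizes as [N₃/Dn₃] / [m_u(1)/m_u(b)] = [t(r_E; ξ̂_E, s²(n−k)⁻¹R_E(XᵀX)⁻¹R_Eᵀ, n−k) / t(r_E; r_E, s²R_E(XᵀX)⁻¹R_Eᵀ, 1)] × [P_post / P_prior], where N₃ = ∫_C ∫₀^∞ (2πσ²)^{−n/2} exp(−‖y − X T⁻¹(r_E, ξ_I)‖²/(2σ²)) (σ²)⁻¹ dσ² dξ_I, Dn₃ = ∫_{C*} ∫₀^∞ (2πσ²)^{−nb/2} exp(−b‖y − X T⁻¹(ξ̂_E, ξ_I)‖²/(2σ²)) (σ²)⁻¹ dσ² dξ_I,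 m_u(c) = ∫_{ℝ^k} ∫₀^∞ (2πσ²)^{−nc/2} exp(−c‖y − Xβ‖²/(2σ²)) (σ²)⁻¹ dσ² dβ, P_post = ∫_C t((r_E, ξ_I); ξ̂, s²(n−k)⁻¹T(XᵀX)⁻¹Tᵀ, n−k) dξ_I / ∫_{ℝ^{k−q_E}} t((r_E, ξ_I); ξ̂, s²(n−k)⁻¹T(XᵀX)⁻¹Tᵀ, n−k) dξ_I, and P_prior = ∫_{C*} t((ξ̂_E, ξ_I); ξ̂, s²T(XᵀX)⁻¹Tᵀ, 1) dξ_I / ∫_{ℝ^{k−q_E}} t((ξ̂_E, ξ_I); ξ̂, s²T(XᵀX)⁻¹Tᵀ, 1) dξ_I. -/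
open Matrix MeasureTheory

/-- The vector `(ξ_E, ξ_I) ∈ ℝ^{q_E} × ℝ^{k−q_E}` stacked into `ℝ^k`. -/
def stackVec {k qE : ℕ} (hq : qE ≤ k) (ξE : Fin qE → ℝ) (ξI : Fin (k - qE) → ℝ) :
    Fin k → ℝ := fun i =>
  Sum.elim ξE ξI ((finSumFinEquiv.trans (finCongr (Nat.add_sub_cancel' hq))).symm i)

/-- The `k × k` matrix `T` obtained by stacking `R_E` on top of `D`. -/
def stackMat {k qE : ℕ} (hq : qE ≤ k) (RE : Matrix (Fin qE) (Fin k) ℝ)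
    (D : Matrix (Fin (k - qE)) (Fin k) ℝ) : Matrix (Fin k) (Fin k) ℝ :=
  (Matrix.fromRows RE D).submatrix
    (finSumFinEquiv.trans (finCongr (Nat.add_sub_cancel' hq))).symm id

theorem exp_neg_mul_dotProduct_self_s14 {ι : Type*} [Fintype ι] (t : ℝ) (x : ι → ℝ) :
    Real.exp (-(t * (x ⬝ᵥ x))) = ∏ i, Real.exp (-t * x i ^ 2) := by
  rw [← Real.exp_sum, ← Finset.mul_sum, neg_mul, dotProduct]
  simp only [pow_two]

theorem integral_exp_neg_mul_dotProduct_self_s14 {ι : Type*} [Fintype ι] {t : ℝ} (ht : 0 < t) :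
    ∫ x : ι → ℝ, Real.exp (-(t * (x ⬝ᵥ x))) = (Real.pi / t) ^ ((Fintype.card ι : ℝ) / 2) := by
  simp_rw [exp_neg_mul_dotProduct_self_s14]
  rw [integral_fintype_prod_volume_eq_pow (fun s : ℝ => Real.exp (-t * s ^ 2)), integral_gaussian,
    Real.sqrt_eq_rpow, ← Real.rpow_mul_natCast (by positivity)]
  congr 1
  ring

theorem integrable_exp_neg_mul_dotProduct_self_s14 {ι : Type*} [Fintype ι] {t : ℝ} (ht : 0 < t) :
    Integrable fun x : ι → ℝ => Real.exp (-(t * (x ⬝ᵥ x))) := by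
  simp_rw [exp_neg_mul_dotProduct_self_s14]
  exact Integrable.fintype_prod (f := fun _ s => Real.exp (-t * s ^ 2))
    fun _ => integrable_exp_neg_mul_sq ht

theorem integrableOn_rpow_mul_exp_neg_mul {a p : ℝ} (ha : 0 < a) (hp : 0 < p) :
    IntegrableOn (fun t : ℝ => t ^ (p - 1) * Real.exp (-(a * t))) (Set.Ioi 0) := by
  simpa using integrableOn_rpow_mul_exp_neg_mul_rpow (s := p - 1) (by linarith) one_pos ha

theorem integral_rpow_neg_add_dotProduct_self {ι : Type*} [Fintype ι] {a p : ℝ} (ha : 0 < a)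
    (hp : (Fintype.card ι : ℝ) / 2 < p) :
    ∫ x : ι → ℝ, (a + x ⬝ᵥ x) ^ (-p) =
      Real.pi ^ ((Fintype.card ι : ℝ) / 2) * Real.Gamma (p - (Fintype.card ι : ℝ) / 2) /
        Real.Gamma p * a ^ ((Fintype.card ι : ℝ) / 2 - p) := by
  set m : ℝ := (Fintype.card ι : ℝ) / 2 with hm
  have hm0 : 0 ≤ m := by positivity
  have hp0 : 0 < p := hm0.trans_lt hp
  have hΓ := Real.Gamma_pos_of_pos hp0
  have hxx : ∀ x : ι → ℝ, 0 ≤ x ⬝ᵥ x := fun x => Finset.sum_nonneg fun i _ => mul_self_nonneg _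
  let F : (ι → ℝ) → ℝ → ℝ := fun x t => t ^ (p - 1) * Real.exp (-((a + x ⬝ᵥ x) * t))
  have hF : ∀ x t, F x t = t ^ (p - 1) * Real.exp (-(a * t)) * Real.exp (-(t * (x ⬝ᵥ x))) :=
    fun x t => by
      simp only [F]
      rw [mul_assoc, ← Real.exp_add]
      ring_nf
  have hinner : ∀ x, ∫ t in Set.Ioi 0, F x t = Real.Gamma p * (a + x ⬝ᵥ x) ^ (-p) := fun x => by
    have hpos : 0 < a + x ⬝ᵥ x := by linarith [hxx x]
    rw [Real.integral_rpow_mul_exp_neg_mul_Ioi hp0 hpos, one_div, Real.inv_rpow hpos.le,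
      ← Real.rpow_neg hpos.le, mul_comm]
  have houter : ∀ t ∈ Set.Ioi (0 : ℝ), ∫ x, F x t =
      Real.pi ^ m * (t ^ ((p - m) - 1) * Real.exp (-(a * t))) := fun t ht => by
    have ht : 0 < t := ht
    simp_rw [hF, integral_const_mul]
    rw [integral_exp_neg_mul_dotProduct_self_s14 ht, ← hm, Real.div_rpow Real.pi_pos.le ht.le,
      show p - m - 1 = (p - 1) - m by ring, Real.rpow_sub ht (p - 1) m]
    ring
  have hmeas : Measurable (Function.uncurry F) := by
    simp only [F, Function.uncurry_def, dotProduct]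
    fun_prop
  have hint : Integrable (Function.uncurry F)
      (volume.prod (volume.restrict (Set.Ioi (0 : ℝ)))) := by
    rw [integrable_prod_iff' hmeas.aestronglyMeasurable]
    constructor
    · filter_upwards [ae_restrict_mem measurableSet_Ioi] with t ht
      simp only [Function.uncurry_apply_pair, hF]
      exact (integrable_exp_neg_mul_dotProduct_self_s14 ht).const_mul _
    · refine Integrable.congr
        ((integrableOn_rpow_mul_exp_neg_mul ha (sub_pos.2 hp)).const_mul (Real.pi ^ m)) ?_
      filter_upwards [ae_restrict_mem measurableSet_Ioi] with t ht
      rw [← houter t ht]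
      refine integral_congr_ae (.of_forall fun x => ?_)
      have ht : 0 < t := ht
      simp only [Function.uncurry_apply_pair, F]
      rw [Real.norm_of_nonneg (by positivity)]
  have hswap := integral_integral_swap hint
  simp_rw [hinner] at hswap
  rw [integral_const_mul, setIntegral_congr_fun measurableSet_Ioi houter, integral_const_mul,
    Real.integral_rpow_mul_exp_neg_mul_Ioi (sub_pos.2 hp) ha, one_div, Real.inv_rpow ha.le,
    ← Real.rpow_neg ha.le, neg_sub] at hswap
  field_simp
  linarith

theorem integral_comp_mulVec_s14 {ι : Type*} [Fintype ι] [DecidableEq ι] {M : Matrix ι ι ℝ}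
    (hM : M.det ≠ 0) (f : (ι → ℝ) → ℝ) :
    ∫ x, f (M *ᵥ x) = |M.det|⁻¹ * ∫ x, f x := by
  have he : MeasurableEmbedding (Matrix.toLin' M) := by
    have := (LinearEquiv.ofIsUnitDet (f := Matrix.toLin' M) (v := Pi.basisFun ℝ ι)
      (v' := Pi.basisFun ℝ ι) (by
        simpa using hM)).toContinuousLinearEquiv.toHomeomorph.measurableEmbedding
    exact this
  have := he.integral_map (μ := volume) f
  rw [Real.map_matrix_volume_pi_eq_smul_volume_pi hM, integral_smul_measure] at this
  simpa [abs_inv] using this.symm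

open scoped MatrixOrder in
theorem exists_eq_transpose_mul_self_of_posDef {ι : Type*} [Fintype ι] [DecidableEq ι]
    {M : Matrix ι ι ℝ} (hM : M.PosDef) : ∃ B : Matrix ι ι ℝ, M = Bᵀ * B := by
  obtain ⟨B, hB⟩ := CStarAlgebra.nonneg_iff_eq_star_mul_self.mp hM.posSemidef.nonneg
  exact ⟨B, by rw [hB, star_eq_conjTranspose, conjTranspose_eq_transpose_of_trivial]⟩

theorem integral_rpow_neg_add_quadratic {ι : Type*} [Fintype ι] [DecidableEq ι]
    {M : Matrix ι ι ℝ} (hM : M.PosDef) (w : ι → ℝ) {a p : ℝ} (ha : 0 < a)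
    (hp : (Fintype.card ι : ℝ) / 2 < p) :
    ∫ x : ι → ℝ, (a + (x - w) ⬝ᵥ M *ᵥ (x - w)) ^ (-p) =
      Real.pi ^ ((Fintype.card ι : ℝ) / 2) * Real.Gamma (p - (Fintype.card ι : ℝ) / 2) /
        Real.Gamma p * a ^ ((Fintype.card ι : ℝ) / 2 - p) * (√M.det)⁻¹ := by
  obtain ⟨B, hB⟩ := exists_eq_transpose_mul_self_of_posDef hM
  have hdet : M.det = B.det ^ 2 := by rw [hB, det_mul, det_transpose, sq]
  have hB0 : B.det ≠ 0 := fun h => hM.det_pos.ne' (by simp [hdet, h])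
  rw [integral_sub_right_eq_self (fun x : ι → ℝ => (a + x ⬝ᵥ M *ᵥ x) ^ (-p)) w]
  have h : ∀ x, x ⬝ᵥ M *ᵥ x = (B *ᵥ x) ⬝ᵥ (B *ᵥ x) := fun x => by
    rw [hB, ← mulVec_mulVec, dotProduct_mulVec, vecMul_transpose]
  simp_rw [h]
  rw [integral_comp_mulVec_s14 hB0 (fun x => (a + x ⬝ᵥ x) ^ (-p)),
    integral_rpow_neg_add_dotProduct_self ha hp, hdet, Real.sqrt_sq_eq_abs]
  ring

theorem integral_rpow_neg_add_quadratic_inv_div {ι : Type*} [Fintype ι] [DecidableEq ι]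
    {S : Matrix ι ι ℝ} (hS : S.PosDef) (w : ι → ℝ) {ν a p : ℝ} (hν : 0 < ν) (ha : 0 < a)
    (hp : (Fintype.card ι : ℝ) / 2 < p) :
    ∫ x : ι → ℝ, (a + (x - w) ⬝ᵥ S⁻¹ *ᵥ (x - w) / ν) ^ (-p) =
      (ν * Real.pi) ^ ((Fintype.card ι : ℝ) / 2) * Real.Gamma (p - (Fintype.card ι : ℝ) / 2) /
        Real.Gamma p * a ^ ((Fintype.card ι : ℝ) / 2 - p) * √S.det := by
  have h : ∀ x : ι → ℝ, x ⬝ᵥ S⁻¹ *ᵥ x / ν = x ⬝ᵥ (ν⁻¹ • S⁻¹) *ᵥ x := fun x => by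
    rw [smul_mulVec, dotProduct_smul, smul_eq_mul]
    ring
  simp_rw [h]
  rw [integral_rpow_neg_add_quadratic (hS.inv.smul (inv_pos.2 hν)) w ha hp, det_smul,
    det_nonsing_inv, Ring.inverse_eq_inv', Real.sqrt_mul (by positivity), Real.sqrt_inv,
    mul_inv, inv_inv, Real.mul_rpow hν.le Real.pi_pos.le, inv_pow, Real.sqrt_inv, inv_inv,
    Real.sqrt_eq_rpow (_ ^ _), ← Real.rpow_natCast_mul hν.le]
  ring_nf

/-- Completing the square: the quadratic form of the inverse of a positive definite block matrix
splits into a marginal and a conditional (Schur complement) part. -/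
theorem exists_schur_decomposition {α β : Type*} [Fintype α] [DecidableEq α] [Fintype β]
    [DecidableEq β] {S : Matrix (α ⊕ β) (α ⊕ β) ℝ} (hS : S.PosDef) :
    ∃ (Z : Matrix β β ℝ) (L : Matrix β α ℝ), Z.PosDef ∧ S.det = S.toBlocks₁₁.det * Z.det ∧
      ∀ u v, Sum.elim u v ⬝ᵥ S⁻¹ *ᵥ Sum.elim u v =
        u ⬝ᵥ S.toBlocks₁₁⁻¹ *ᵥ u + (v - L *ᵥ u) ⬝ᵥ Z⁻¹ *ᵥ (v - L *ᵥ u) := by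
  obtain ⟨A, B, C, D, rfl⟩ : ∃ A B C D, S = fromBlocks A B C D :=
    ⟨_, _, _, _, (fromBlocks_toBlocks S).symm⟩
  have hA : A.PosDef := hS.submatrix Sum.inl_injective
  have hAu : IsUnit A.det := hA.det_pos.ne'.isUnit
  have hAt : Aᵀ = A := by simpa using hA.isHermitian.eq
  have hBC : Bᵀ = C := by
    have := hS.isHermitian.eq
    rw [conjTranspose_eq_transpose_of_trivial, fromBlocks_transpose, fromBlocks_inj] at this
    exact this.2.2.1
  set V : Matrix (α ⊕ β) (α ⊕ β) ℝ := fromBlocks 1 0 (-(C * A⁻¹)) 1 with hV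
  have hVdet : V.det = 1 := by simp [hV]
  have hAit : A⁻¹ᵀ = A⁻¹ := by rw [transpose_nonsing_inv, hAt]
  have hΔ : V * fromBlocks A B C D * Vᵀ = fromBlocks A 0 0 (D - C * A⁻¹ * B) := by
    have hCB : Cᵀ = B := by rw [← hBC, transpose_transpose]
    rw [hV, fromBlocks_transpose, fromBlocks_multiply, fromBlocks_multiply]
    simp only [transpose_one, transpose_zero, transpose_neg, transpose_mul, hAit, hCB,
      Matrix.one_mul, Matrix.zero_mul, Matrix.mul_one, Matrix.mul_zero, add_zero, Matrix.neg_mul,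
      Matrix.mul_neg, Matrix.mul_assoc, nonsing_inv_mul A hAu, mul_nonsing_inv_cancel_left A _ hAu]
    congr 1 <;> simp [sub_eq_neg_add]
  have hVu : IsUnit V.det := by simp [hVdet]
  have hΔpos : (fromBlocks A 0 0 (D - C * A⁻¹ * B)).PosDef := by
    rw [← hΔ, ← conjTranspose_eq_transpose_of_trivial]
    exact hS.mul_mul_conjTranspose_same
      (vecMul_injective_of_isUnit ((isUnit_iff_isUnit_det V).2 hVu))
  have hZ : (D - C * A⁻¹ * B).PosDef := hΔpos.submatrix Sum.inr_injective
  refine ⟨D - C * A⁻¹ * B, C * A⁻¹, hZ, ?_, fun u v => ?_⟩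
  · have := congrArg det hΔ
    rw [det_mul, det_mul, det_transpose, hVdet, det_fromBlocks_zero₂₁] at this
    simpa using this
  · have hinv : (fromBlocks A B C D)⁻¹ =
        Vᵀ * (fromBlocks A⁻¹ 0 0 (D - C * A⁻¹ * B)⁻¹ * V) := by
      refine inv_eq_right_inv ?_
      rw [← Matrix.mul_assoc, ← Matrix.mul_assoc, mul_eq_one_comm, ← Matrix.mul_assoc,
        ← Matrix.mul_assoc, hΔ, fromBlocks_multiply]
      simp [mul_nonsing_inv A hAu, mul_nonsing_inv _ hZ.det_pos.ne'.isUnit]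
    rw [hinv, ← mulVec_mulVec, dotProduct_mulVec, vecMul_transpose, ← mulVec_mulVec, hV,
      fromBlocks_mulVec]
    simp only [toBlocks_fromBlocks₁₁, Sum.elim_comp_inl, Sum.elim_comp_inr, one_mulVec,
      zero_mulVec, add_zero, fromBlocks_mulVec, neg_mulVec, zero_add, neg_add_eq_sub,
      sumElim_dotProduct_sumElim]

theorem fracInt_eq_Gamma {n : ℕ} {c q : ℝ} (hn : 0 < (n : ℝ) * c) (hc : 0 < c) (hq : 0 < q) :
    fracInt n c q = Real.Gamma (n * c / 2) * (Real.pi * c * q) ^ (-(n * c) / 2) := by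
  rw [fracInt, ← integral_comp_rpow_Ioi _ (neg_ne_zero.2 one_ne_zero)]
  have h : ∀ x ∈ Set.Ioi (0 : ℝ), (|(-1 : ℝ)| * x ^ ((-1 : ℝ) - 1)) •
      ((2 * Real.pi * x ^ (-1 : ℝ)) ^ (-((n : ℝ) * c) / 2) *
        Real.exp (-(c * q) / (2 * x ^ (-1 : ℝ))) * (x ^ (-1 : ℝ))⁻¹) =
      (2 * Real.pi) ^ (-((n : ℝ) * c) / 2) *
        (x ^ ((n : ℝ) * c / 2 - 1) * Real.exp (-(c * q / 2 * x))) := fun x hx => by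
    have hx : 0 < x := hx
    rw [Real.mul_rpow (by positivity) (by positivity), ← Real.rpow_mul hx.le, Real.rpow_neg_one,
      show (-1 : ℝ) - 1 = -2 by norm_num, show (-1 : ℝ) * (-((n : ℝ) * c) / 2) = n * c / 2 by ring,
      Real.rpow_neg hx.le, Real.rpow_two, Real.rpow_sub_one hx.ne', inv_inv,
      show -(c * q) / (2 * x⁻¹) = -(c * q / 2 * x) by field_simp, smul_eq_mul]
    simp only [abs_neg, abs_one]
    field_simp
  rw [setIntegral_congr_fun measurableSet_Ioi h, integral_const_mul,
    Real.integral_rpow_mul_exp_neg_mul_Ioi (by positivity) (by positivity), one_div,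
    Real.inv_rpow (by positivity), ← Real.rpow_neg (by positivity), ← neg_div, ← mul_assoc,
    ← Real.mul_rpow (by positivity) (by positivity)]
  ring_nf

theorem stackVec_eq_comp {k qE : ℕ} (hq : qE ≤ k) (u : Fin qE → ℝ) (v : Fin (k - qE) → ℝ) :
    stackVec hq u v =
      Sum.elim u v ∘ (finSumFinEquiv.trans (finCongr (Nat.add_sub_cancel' hq))).symm := rfl

theorem dotProduct_inv_mulVec_submatrix_equiv {ι κ : Type*} [Fintype ι] [DecidableEq ι]
    [Fintype κ] [DecidableEq κ] (e : κ ≃ ι) (S : Matrix ι ι ℝ) (x : ι → ℝ) :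
    x ⬝ᵥ S⁻¹ *ᵥ x = (x ∘ e) ⬝ᵥ (S.submatrix e e)⁻¹ *ᵥ (x ∘ e) := by
  rw [inv_submatrix_equiv, submatrix_mulVec_equiv, Function.comp_assoc, e.self_comp_symm,
    Function.comp_id, comp_equiv_dotProduct_comp_equiv]

/-- Marginals of a multivariate Student `t` distribution are Student `t`. -/
theorem integral_studentT_stackVec {k qE : ℕ} (hq : qE ≤ k) {ν : ℝ} (hν : 0 < ν) (m : Fin k → ℝ)
    {S : Matrix (Fin k) (Fin k) ℝ} (hS : S.PosDef) (u : Fin qE → ℝ)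
    (e : Fin qE ⊕ Fin (k - qE) ≃ Fin k)
    (he : e = finSumFinEquiv.trans (finCongr (Nat.add_sub_cancel' hq))) :
    ∫ v, studentT ν m S (stackVec hq u v) =
      studentT ν (m ∘ e ∘ Sum.inl) (S.submatrix (e ∘ Sum.inl) (e ∘ Sum.inl)) u := by
  have hS' : (S.submatrix e e).PosDef := hS.submatrix e.injective
  obtain ⟨Z, L, hZ, hdet, hquad⟩ := exists_schur_decomposition hS'
  have h11 : (S.submatrix e e).toBlocks₁₁ = S.submatrix (e ∘ Sum.inl) (e ∘ Sum.inl) := rfl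
  rw [h11] at hdet hquad
  have hA : (S.submatrix (e ∘ Sum.inl) (e ∘ Sum.inl)).PosDef :=
    hS.submatrix (e.injective.comp Sum.inl_injective)
  rw [det_submatrix_equiv_self] at hdet
  set A := S.submatrix (e ∘ Sum.inl) (e ∘ Sum.inl)
  set μE := m ∘ e ∘ Sum.inl
  set μI := m ∘ e ∘ Sum.inr
  have hQ : ∀ v, (stackVec hq u v - m) ⬝ᵥ S⁻¹ *ᵥ (stackVec hq u v - m) =
      (u - μE) ⬝ᵥ A⁻¹ *ᵥ (u - μE) + (v - (μI + L *ᵥ (u - μE))) ⬝ᵥ Z⁻¹ *ᵥ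
        (v - (μI + L *ᵥ (u - μE))) := fun v => by
    have hx : (stackVec hq u v - m) ∘ e = Sum.elim (u - μE) (v - μI) := by
      rw [stackVec_eq_comp, ← he]
      ext (i | i) <;> simp [μE, μI]
    rw [dotProduct_inv_mulVec_submatrix_equiv e, hx, hquad, sub_sub]
  have hQ0 : 0 ≤ (u - μE) ⬝ᵥ A⁻¹ *ᵥ (u - μE) := hA.inv.posSemidef.dotProduct_mulVec_nonneg _
  have hAd := hA.det_pos
  have hZd := hZ.det_pos
  have hk : ((k - qE : ℕ) : ℝ) = k - qE := Nat.cast_sub hq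
  have hqk : (qE : ℝ) ≤ k := by exact_mod_cast hq
  have hq0 : (0 : ℝ) ≤ qE := by positivity
  have h1 := Real.Gamma_pos_of_pos (s := (ν + k) / 2) (by positivity)
  have h2 := Real.Gamma_pos_of_pos (half_pos hν)
  have h3 := Real.Gamma_pos_of_pos (s := (ν + qE) / 2) (by positivity)
  simp only [studentT, integral_const_mul, neg_div, hQ, add_div, ← add_assoc]
  simp only [← add_div]
  rw [integral_rpow_neg_add_quadratic_inv_div hZ _ hν (by positivity)
    (by rw [Fintype.card_fin, hk]; linarith), Fintype.card_fin, hk, hdet, Real.sqrt_mul hAd.le,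
    show (ν + k) / 2 - ((k : ℝ) - qE) / 2 = (ν + qE) / 2 by ring,
    show ((k : ℝ) - qE) / 2 - (ν + k) / 2 = -((ν + qE) / 2) by ring,
    show ((k : ℝ) - qE) / 2 = k / 2 - qE / 2 by ring, Real.rpow_sub (by positivity)]
  have h4 : 0 < (ν * Real.pi) ^ ((k : ℝ) / 2) := by positivity
  have h5 : 0 < (ν * Real.pi) ^ ((qE : ℝ) / 2) := by positivity
  field_simp

theorem fracInt_eq_studentT {n d : ℕ} {ν c s : ℝ} (hν : 0 < ν) (hc : 0 < c) (hs : 0 < s)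
    (hcν : n * c = ν + d) {m x : Fin d → ℝ} {G : Matrix (Fin d) (Fin d) ℝ} (hG : G.PosDef) :
    fracInt n c (s + (x - m) ⬝ᵥ G⁻¹ *ᵥ (x - m)) =
      (Real.pi * c * s) ^ (-(ν + d) / 2) * Real.Gamma (ν / 2) * (ν * Real.pi) ^ ((d : ℝ) / 2) *
        √((s / ν) • G).det * studentT ν m ((s / ν) • G) x := by
  have hQ0 : 0 ≤ (x - m) ⬝ᵥ G⁻¹ *ᵥ (x - m) := hG.inv.posSemidef.dotProduct_mulVec_nonneg _
  have hS : ((s / ν) • G).PosDef := hG.smul (div_pos hs hν)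
  have hdet := hS.det_pos
  have hinv : ((s / ν) • G)⁻¹ = (ν / s) • G⁻¹ := by
    refine inv_eq_right_inv ?_
    rw [smul_mul_smul_comm, mul_nonsing_inv _ hG.det_pos.ne'.isUnit,
      div_mul_div_cancel₀' hs.ne' , div_self hν.ne', one_smul]
  have h2 := Real.Gamma_pos_of_pos (half_pos hν)
  have h4 : 0 < (ν * Real.pi) ^ ((d : ℝ) / 2) := by positivity
  rw [fracInt_eq_Gamma (by rw [hcν]; positivity) hc (by positivity), hcν, studentT, hinv,
    smul_mulVec, dotProduct_smul, smul_eq_mul]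
  set Q := (x - m) ⬝ᵥ G⁻¹ *ᵥ (x - m)
  rw [show Real.pi * c * (s + Q) = Real.pi * c * s * (1 + ν / s * Q / ν) by field_simp,
    Real.mul_rpow (by positivity) (by positivity)]
  field_simp

theorem dotProduct_self_sub_mulVec {n k : ℕ} (y : Fin n → ℝ) (X : Matrix (Fin n) (Fin k) ℝ)
    (hX : IsUnit (Xᵀ * X)) (β : Fin k → ℝ) :
    (y - X *ᵥ β) ⬝ᵥ (y - X *ᵥ β) =
      sSq y X + (β - betaHat y X) ⬝ᵥ (Xᵀ * X) *ᵥ (β - betaHat y X) := by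
  have hN : Xᵀ *ᵥ (y - X *ᵥ betaHat y X) = 0 := by
    rw [mulVec_sub, mulVec_mulVec, betaHat, mulVec_mulVec,
      mul_nonsing_inv _ ((isUnit_iff_isUnit_det _).1 hX), one_mulVec, sub_self]
  have h1 : y - X *ᵥ β = (y - X *ᵥ betaHat y X) - X *ᵥ (β - betaHat y X) := by
    rw [mulVec_sub]
    abel
  have h2 : ∀ w, (y - X *ᵥ betaHat y X) ⬝ᵥ X *ᵥ w = 0 := fun w => by
    rw [dotProduct_mulVec, ← mulVec_transpose, hN, zero_dotProduct]
  rw [h1, sub_dotProduct, dotProduct_sub (y - _), h2,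
    dotProduct_sub (X *ᵥ _), dotProduct_comm (X *ᵥ _) (y - _), h2, sSq, ← mulVec_mulVec,
    dotProduct_mulVec _ Xᵀ, vecMul_transpose]
  ring

theorem mU_eq {n k : ℕ} (y : Fin n → ℝ) {X : Matrix (Fin n) (Fin k) ℝ} (hX : IsUnit (Xᵀ * X))
    (hs : 0 < sSq y X) {ν c : ℝ} (hν : 0 < ν) (hc : 0 < c) (hcν : n * c = ν + k) :
    mU y X c = (Real.pi * c * sSq y X) ^ (-(ν + k) / 2) * Real.Gamma (ν / 2) *
      (ν * Real.pi) ^ ((k : ℝ) / 2) * √((sSq y X / ν) • (Xᵀ * X)⁻¹).det := by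
  have hG := (posDef_transpose_mul_self hX).inv
  have h := fun β => fracInt_eq_studentT (m := betaHat y X) (x := β) hν hc hs hcν hG
  rw [nonsing_inv_nonsing_inv _ ((isUnit_iff_isUnit_det _).1 hX)] at h
  simp_rw [mU, dotProduct_self_sub_mulVec y X hX, h, integral_const_mul]
  rw [integral_studentT hν _ (hG.smul (div_pos hs hν)), mul_one]

theorem fracInt_reparametrized {n k : ℕ} (y : Fin n → ℝ) {X : Matrix (Fin n) (Fin k) ℝ}
    (hX : IsUnit (Xᵀ * X)) (hs : 0 < sSq y X) {ν c : ℝ} (hν : 0 < ν) (hc : 0 < c)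
    (hcν : n * c = ν + k) {T : Matrix (Fin k) (Fin k) ℝ} (hT : IsUnit T.det) (ξ : Fin k → ℝ) :
    fracInt n c ((y - X *ᵥ (T⁻¹ *ᵥ ξ)) ⬝ᵥ (y - X *ᵥ (T⁻¹ *ᵥ ξ))) =
      |T.det| * mU y X c *
        studentT ν (T *ᵥ betaHat y X) ((sSq y X / ν) • (T * (Xᵀ * X)⁻¹ * Tᵀ)) ξ := by
  have hA := posDef_transpose_mul_self hX
  have hTu : IsUnit T := (isUnit_iff_isUnit_det T).2 hT
  have hG : (T * (Xᵀ * X)⁻¹ * Tᵀ).PosDef := by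
    rw [← conjTranspose_eq_transpose_of_trivial]
    exact hA.inv.mul_mul_conjTranspose_same (vecMul_injective_of_isUnit hTu)
  have hquad : (T⁻¹ *ᵥ ξ - betaHat y X) ⬝ᵥ (Xᵀ * X) *ᵥ (T⁻¹ *ᵥ ξ - betaHat y X) =
      (ξ - T *ᵥ betaHat y X) ⬝ᵥ (T * (Xᵀ * X)⁻¹ * Tᵀ)⁻¹ *ᵥ (ξ - T *ᵥ betaHat y X) := by
    have h1 : T⁻¹ *ᵥ ξ - betaHat y X = T⁻¹ *ᵥ (ξ - T *ᵥ betaHat y X) := by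
      rw [mulVec_sub, mulVec_mulVec, nonsing_inv_mul _ hT, one_mulVec]
    rw [h1, Matrix.mul_inv_rev, Matrix.mul_inv_rev, ← transpose_nonsing_inv,
      nonsing_inv_nonsing_inv _ ((isUnit_iff_isUnit_det _).1 hX)]
    simp only [← mulVec_mulVec]
    rw [dotProduct_mulVec (ξ - _) T⁻¹ᵀ, vecMul_transpose]
  have hdet : √((sSq y X / ν) • (T * (Xᵀ * X)⁻¹ * Tᵀ)).det =
      |T.det| * √((sSq y X / ν) • (Xᵀ * X)⁻¹).det := by
    rw [← Real.sqrt_sq_eq_abs, ← Real.sqrt_mul (sq_nonneg _), det_smul, det_smul, det_mul, det_mul,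
      det_transpose]
    ring_nf
  rw [dotProduct_self_sub_mulVec y X hX, hquad, fracInt_eq_studentT hν hc hs hcν hG, hdet,
    mU_eq y hX hs hν hc hcν]
  ring

theorem isUnit_det_stackMat {k qE : ℕ} (hq : qE ≤ k) {RE : Matrix (Fin qE) (Fin k) ℝ}
    {D : Matrix (Fin (k - qE)) (Fin k) ℝ} (hRE : RE.rank = qE) (hD : D.rank = k - qE)
    (hDRE : D * REᵀ = 0) : IsUnit (stackMat hq RE D).det := by
  have full : ∀ {r : ℕ} (M : Matrix (Fin r) (Fin k) ℝ), M.rank = r → IsUnit (M * Mᵀ) :=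
    fun {r} M hM => by
      rw [← mulVec_injective_iff_isUnit, ← coe_mulVecLin, LinearMap.injective_iff_surjective,
        ← LinearMap.range_eq_top]
      apply Submodule.eq_top_of_finrank_eq
      rw [← Matrix.rank, rank_self_mul_transpose, hM, Module.finrank_fin_fun]
  have hEI : RE * Dᵀ = 0 := by
    rw [← transpose_transpose RE, ← transpose_mul, hDRE, transpose_zero]
  have hTT : stackMat hq RE D * (stackMat hq RE D)ᵀ =
      (fromBlocks (RE * REᵀ) 0 0 (D * Dᵀ)).submatrix
        (finSumFinEquiv.trans (finCongr (Nat.add_sub_cancel' hq))).symm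
        (finSumFinEquiv.trans (finCongr (Nat.add_sub_cancel' hq))).symm := by
    rw [stackMat, transpose_submatrix, ← submatrix_mul _ _ _ _ _ Function.bijective_id,
      transpose_fromRows, fromRows_mul_fromCols, hDRE, hEI]
  have h : IsUnit (stackMat hq RE D * (stackMat hq RE D)ᵀ) := by
    rw [hTT, isUnit_submatrix_equiv, isUnit_fromBlocks_zero₂₁]
    exact ⟨full RE hRE, full D hD⟩
  rw [isUnit_iff_isUnit_det, det_mul, det_transpose] at h
  exact isUnit_of_mul_isUnit_left h

theorem studentT_pos {d : ℕ} {ν : ℝ} (hν : 0 < ν) (m x : Fin d → ℝ)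
    {S : Matrix (Fin d) (Fin d) ℝ} (hS : S.PosDef) : 0 < studentT ν m S x := by
  have hQ0 : 0 ≤ (x - m) ⬝ᵥ S⁻¹ *ᵥ (x - m) := hS.inv.posSemidef.dotProduct_mulVec_nonneg _
  have hdet := hS.det_pos
  have h1 := Real.Gamma_pos_of_pos (s := (ν + d) / 2) (by positivity)
  have h2 := Real.Gamma_pos_of_pos (half_pos hν)
  rw [studentT]
  positivity

theorem mU_pos {n k : ℕ} (y : Fin n → ℝ) {X : Matrix (Fin n) (Fin k) ℝ} (hX : IsUnit (Xᵀ * X))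
    (hs : 0 < sSq y X) {ν c : ℝ} (hν : 0 < ν) (hc : 0 < c) (hcν : n * c = ν + k) :
    0 < mU y X c := by
  have hdet := ((posDef_transpose_mul_self hX).inv.smul (div_pos hs hν)).det_pos
  have h2 := Real.Gamma_pos_of_pos (half_pos hν)
  rw [mU_eq y hX hs hν hc hcν]
  positivity

theorem integral_studentT_stackMat {k qE : ℕ} (hq : qE ≤ k) {ν c : ℝ} (hν : 0 < ν) (hc : 0 < c)
    {RE : Matrix (Fin qE) (Fin k) ℝ} {D : Matrix (Fin (k - qE)) (Fin k) ℝ}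
    (hT : IsUnit (stackMat hq RE D).det) {G : Matrix (Fin k) (Fin k) ℝ} (hG : G.PosDef)
    (β : Fin k → ℝ) (u : Fin qE → ℝ) :
    0 < studentT ν (RE *ᵥ β) (c • (RE * G * REᵀ)) u ∧
      ∫ v, studentT ν (stackMat hq RE D *ᵥ β)
        (c • (stackMat hq RE D * G * (stackMat hq RE D)ᵀ)) (stackVec hq u v) =
          studentT ν (RE *ᵥ β) (c • (RE * G * REᵀ)) u := by
  set e := finSumFinEquiv.trans (finCongr (Nat.add_sub_cancel' hq)) with he
  set T := stackMat hq RE D with hTdef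
  have hS : (c • (T * G * Tᵀ)).PosDef := by
    rw [← conjTranspose_eq_transpose_of_trivial]
    exact (hG.mul_mul_conjTranspose_same
      (vecMul_injective_of_isUnit ((isUnit_iff_isUnit_det T).2 hT))).smul hc
  have hrow : ∀ i, T (e (Sum.inl i)) = RE i := fun i => by
    ext j
    rw [hTdef, stackMat, ← he, submatrix_apply, e.symm_apply_apply]
    rfl
  have hμ : (T *ᵥ β) ∘ e ∘ Sum.inl = RE *ᵥ β := by
    ext i
    simp only [Function.comp_apply, mulVec, hrow]
  have hsub : T.submatrix (e ∘ Sum.inl) id = RE := by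
    ext i j
    simp only [submatrix_apply, Function.comp_apply, hrow, id]
  have hScov : (c • (T * G * Tᵀ)).submatrix (e ∘ Sum.inl) (e ∘ Sum.inl) = c • (RE * G * REᵀ) := by
    rw [← hsub, transpose_submatrix]
    rfl
  constructor
  · rw [← hScov]
    exact studentT_pos hν _ _ (hS.submatrix (e.injective.comp Sum.inl_injective))
  · rw [integral_studentT_stackVec hq hν _ hS u e he, hμ, hScov]

/-- **Lemma 1, combined equality-and-inequality part; Appendix A
decomposition.** With `b = (k+1)/n`, the prior adjusted default Bayes factor of
`H₃ : R_E β = r_E, R_I β > r_I` against the unconstrained hypothesis factorizes as a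
Savage–Dickey density ratio times a ratio of conditional posterior and fractional prior
probabilities of the inequality-constrained region. -/
theorem stmt_14 {n k qE qI : ℕ} (hnk : k < n) (hq : qE ≤ k)
    (y : Fin n → ℝ) (X : Matrix (Fin n) (Fin k) ℝ) (hX : IsUnit (Xᵀ * X))
    (hs2 : 0 < sSq y X)
    (RE : Matrix (Fin qE) (Fin k) ℝ) (rE : Fin qE → ℝ)
    (RI : Matrix (Fin qI) (Fin k) ℝ) (rI : Fin qI → ℝ)
    (D : Matrix (Fin (k - qE)) (Fin k) ℝ)
    (hRE : RE.rank = qE) (hD : D.rank = k - qE) (hDRE : D * REᵀ = 0) :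
    let b : ℝ := ((k : ℝ) + 1) / n
    let βhat := betaHat y X
    let s2 := sSq y X
    let T := stackMat hq RE D
    let ξhat := T.mulVec βhat
    let ξhatE := RE.mulVec βhat
    let ξhatI := D.mulVec βhat
    let RtI := RI * (Dᵀ * (D * Dᵀ)⁻¹)
    let rtI := rI - (RI * (REᵀ * (RE * REᵀ)⁻¹)).mulVec rE
    let C := {ξI : Fin (k - qE) → ℝ | ∀ i, rtI i < (RtI.mulVec ξI) i}
    let Cstar := {ξI : Fin (k - qE) → ℝ | ∀ i, (RtI.mulVec ξhatI) i < (RtI.mulVec ξI) i}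
    let N₃ := ∫ ξI in C,
      fracInt n 1 ((y - X.mulVec (T⁻¹.mulVec (stackVec hq rE ξI))) ⬝ᵥ
        (y - X.mulVec (T⁻¹.mulVec (stackVec hq rE ξI))))
    let Dn₃ := ∫ ξI in Cstar,
      fracInt n b ((y - X.mulVec (T⁻¹.mulVec (stackVec hq ξhatE ξI))) ⬝ᵥ
        (y - X.mulVec (T⁻¹.mulVec (stackVec hq ξhatE ξI))))
    let Spost := (s2 / ((n : ℝ) - k)) • (T * (Xᵀ * X)⁻¹ * Tᵀ)
    let Sprior := s2 • (T * (Xᵀ * X)⁻¹ * Tᵀ)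
    let Ppost := (∫ ξI in C, studentT ((n : ℝ) - k) ξhat Spost (stackVec hq rE ξI)) /
      (∫ ξI : Fin (k - qE) → ℝ, studentT ((n : ℝ) - k) ξhat Spost (stackVec hq rE ξI))
    let Pprior := (∫ ξI in Cstar, studentT 1 ξhat Sprior (stackVec hq ξhatE ξI)) /
      (∫ ξI : Fin (k - qE) → ℝ, studentT 1 ξhat Sprior (stackVec hq ξhatE ξI))
    (N₃ / Dn₃) / (mU y X 1 / mU y X b) =
      (studentT ((n : ℝ) - k) ξhatE
            ((s2 / ((n : ℝ) - k)) • (RE * (Xᵀ * X)⁻¹ * REᵀ)) rE /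
          studentT 1 rE (s2 • (RE * (Xᵀ * X)⁻¹ * REᵀ)) rE) *
        (Ppost / Pprior) := by
  intro b βhat s2 T ξhat ξhatE ξhatI RtI rtI C Cstar N₃ Dn₃ Spost Sprior Ppost Pprior
  have hn : (0 : ℝ) < n := by exact_mod_cast (Nat.zero_le k).trans_lt hnk
  have hν : (0 : ℝ) < (n : ℝ) - k := sub_pos.2 (by exact_mod_cast hnk)
  have hb : 0 < b := by positivity
  have hT : IsUnit T.det := isUnit_det_stackMat hq hRE hD hDRE
  have hTdet : |T.det| ≠ 0 := abs_ne_zero.2 hT.ne_zero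
  have hA := (posDef_transpose_mul_self hX).inv
  have h1 : (n : ℝ) * 1 = ((n : ℝ) - k) + k := by ring
  have hbν : (n : ℝ) * b = 1 + k := by
    simp only [b]
    field_simp
    ring
  have hN : N₃ = |T.det| * mU y X 1 *
      ∫ ξI in C, studentT ((n : ℝ) - k) ξhat Spost (stackVec hq rE ξI) := by
    simp only [N₃, fracInt_reparametrized y hX hs2 hν one_pos h1 hT, integral_const_mul]
    rfl
  have hDn : Dn₃ = |T.det| * mU y X b *
      ∫ ξI in Cstar, studentT 1 ξhat Sprior (stackVec hq ξhatE ξI) := by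
    simp only [Dn₃, fracInt_reparametrized y hX hs2 one_pos hb hbν hT, integral_const_mul, div_one]
    rfl
  obtain ⟨hpost0, hpost⟩ :=
    integral_studentT_stackMat hq hν (div_pos hs2 hν) hT hA βhat rE
  obtain ⟨hprior0, hprior⟩ := integral_studentT_stackMat hq one_pos hs2 hT hA βhat ξhatE
  have hmode : studentT 1 rE (s2 • (RE * (Xᵀ * X)⁻¹ * REᵀ)) rE =
      studentT 1 ξhatE (s2 • (RE * (Xᵀ * X)⁻¹ * REᵀ)) ξhatE := by
    simp only [studentT, sub_self]
  have hm1 := (mU_pos y hX hs2 hν one_pos h1).ne'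
  have hmb := (mU_pos y hX hs2 one_pos hb hbν).ne'
  have hPpost : Ppost = (∫ ξI in C, studentT ((n : ℝ) - k) ξhat Spost (stackVec hq rE ξI)) /
      studentT ((n : ℝ) - k) ξhatE ((s2 / ((n : ℝ) - k)) • (RE * (Xᵀ * X)⁻¹ * REᵀ)) rE :=
    congrArg (_ / ·) hpost
  have hPprior : Pprior = (∫ ξI in Cstar, studentT 1 ξhat Sprior (stackVec hq ξhatE ξI)) /
      studentT 1 ξhatE (s2 • (RE * (Xᵀ * X)⁻¹ * REᵀ)) ξhatE :=
    congrArg (_ / ·) hprior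
  rw [hN, hDn, hPpost, hPprior, hmode]
  have hM1 := hpost0.ne'
  have hMb := hprior0.ne'
  generalize (∫ ξI in C, studentT ((n : ℝ) - k) ξhat Spost (stackVec hq rE ξI)) = I₁
  generalize (∫ ξI in Cstar, studentT 1 ξhat Sprior (stackVec hq ξhatE ξI)) = I₂
  change studentT ((n : ℝ) - k) ξhatE ((s2 / ((n : ℝ) - k)) • (RE * (Xᵀ * X)⁻¹ * REᵀ)) rE ≠ 0 at hM1
  change studentT 1 ξhatE (s2 • (RE * (Xᵀ * X)⁻¹ * REᵀ)) ξhatE ≠ 0 at hMb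
  field_simp
end
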